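/- arXiv:1604.03432 — 3 statements merged into one kernel-verified Lean document; each statement's English description precedes it below -/
import Mathlib

section
/- Let p ∈ [0, 1/2) and b ∈ [1/2, 1-p]. Then the supremum of H₂(π(1-p) + (1-π)p) − H₂(p) over all π ∈ [0,1] satisfying π(1-p) + (1-π)p ≥ b equals H₂(b) − H₂(p), and it is attained at π = (b - p)/(1 - 2p). (This is the information-energy capacity function C(b) of the binary symmetric channel with crossover probability p in the energy-constrained regime; the maximum feasible energy rate is 1 − p, attained when the symbol 1 is always transmitted.) -/
/-- The binary entropy function `H₂(x) = -x·log₂ x - (1-x)·log₂(1-x)`,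
with the convention `0·log₂ 0 = 0` (automatic since `Real.logb 2 0 = 0`). -/
noncomputable def binEnt (x : ℝ) : ℝ :=
  -x * Real.logb 2 x - (1 - x) * Real.logb 2 (1 - x)

theorem binEnt_eq_binEntropy_div_log_two (x : ℝ) : binEnt x = Real.binEntropy x / Real.log 2 := by
  simp only [binEnt, Real.binEntropy, Real.logb, Real.log_inv]
  ring

theorem binEnt_strictAntiOn : StrictAntiOn binEnt (Set.Icc (1 / 2) 1) := by
  intro x hx y hy hxy
  rw [one_div] at hx hy
  rw [binEnt_eq_binEntropy_div_log_two, binEnt_eq_binEntropy_div_log_two]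
  exact div_lt_div_of_pos_right (Real.binEntropy_strictAntiOn hx hy hxy)
    (Real.log_pos one_lt_two)

/-- For a crossover probability `p ∈ [0, 1/2)` and `b ∈ [1/2, 1-p]`, the supremum of
`H₂(π(1-p)+(1-π)p) - H₂(p)` over all `π ∈ [0,1]` with `π(1-p)+(1-π)p ≥ b` equals
`H₂(b) - H₂(p)`, and it is attained at `π = (b-p)/(1-2p)` (information-energy capacity
function of the binary symmetric channel in the energy-constrained regime). -/
theorem bsc_capacity_constrained (p b : ℝ) (hp : p ∈ Set.Ico (0 : ℝ) (1 / 2))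
    (hb : b ∈ Set.Icc (1 / 2 : ℝ) (1 - p)) :
    IsGreatest
      {y : ℝ | ∃ π ∈ Set.Icc (0 : ℝ) 1,
        b ≤ π * (1 - p) + (1 - π) * p ∧ y = binEnt (π * (1 - p) + (1 - π) * p) - binEnt p}
      (binEnt b - binEnt p) ∧
    (b - p) / (1 - 2 * p) ∈ Set.Icc (0 : ℝ) 1 ∧
    b ≤ ((b - p) / (1 - 2 * p)) * (1 - p) + (1 - (b - p) / (1 - 2 * p)) * p ∧
    binEnt (((b - p) / (1 - 2 * p)) * (1 - p) + (1 - (b - p) / (1 - 2 * p)) * p) - binEnt p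
      = binEnt b - binEnt p := by
  obtain ⟨hp0, hp2⟩ := hp
  obtain ⟨hb2, hbp⟩ := hb
  have hpos : 0 < 1 - 2 * p := by linarith
  have hout : (b - p) / (1 - 2 * p) * (1 - p) + (1 - (b - p) / (1 - 2 * p)) * p = b := by
    linear_combination div_mul_cancel₀ (b - p) hpos.ne'
  have hmem : (b - p) / (1 - 2 * p) ∈ Set.Icc (0 : ℝ) 1 :=
    ⟨div_nonneg (by linarith) hpos.le, (div_le_one hpos).2 (by linarith)⟩
  refine ⟨⟨⟨_, hmem, hout.ge, by rw [hout]⟩, ?_⟩, hmem, hout.ge, by rw [hout]⟩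
  rintro y ⟨π, ⟨-, hπ1⟩, hbπ, rfl⟩
  have hle : π * (1 - p) + (1 - π) * p ≤ 1 := by
    linarith [mul_nonneg (sub_nonneg.2 hπ1) hpos.le]
  exact sub_le_sub_right
    (binEnt_strictAntiOn.antitoneOn ⟨hb2, by linarith⟩ ⟨hb2.trans hbπ, hle⟩ hbπ) _
end

section
/- Let ε ∈ (0, 1). Then the supremum over π ∈ [0,1] of f(π) = H₂(π(1-ε)) − π·H₂(ε) equals log₂(1 − ε^{1/(1-ε)} + ε^{ε/(1-ε)}), and it is attained at π* = ε^{ε/(1-ε)} / (1 + (1-ε)·ε^{ε/(1-ε)}). (This is the unconstrained capacity of the Z-channel with 1-to-0 crossover probability ε and its capacity-achieving input distribution Bernoulli(π*).) -/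
/-- The binary entropy in terms of natural logarithms. -/
lemma binEnt_eq_div (x : ℝ) :
    binEnt x = (-x * Real.log x - (1 - x) * Real.log (1 - x)) / Real.log 2 := by
  simp only [binEnt, Real.logb]
  ring

/-- Gibbs' inequality for a single pair of weights. -/
lemma mul_log_sub_mul_log_le {x y : ℝ} (hx : 0 ≤ x) (hy : 0 < y) :
    x * Real.log y - x * Real.log x ≤ y - x := by
  rcases hx.eq_or_lt with rfl | hx
  · simpa using hy.le
  · have h := mul_le_mul_of_nonneg_left (Real.log_le_sub_one_of_pos (div_pos hy hx)) hx.le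
    rw [Real.log_div hy.ne' hx.ne', mul_sub, mul_sub, mul_div_cancel₀ _ hx.ne'] at h
    linarith

/-- The tangent line of the binary entropy at `a / (1 + a)` lies above it. -/
lemma binEnt_le_logb_one_add_sub {a x : ℝ} (ha : 0 < a) (hx : x ∈ Set.Icc (0 : ℝ) 1) :
    binEnt x ≤ Real.logb 2 (1 + a) - x * Real.logb 2 a := by
  have hD : 0 < 1 + a := by positivity
  have h1 := mul_log_sub_mul_log_le hx.1 (div_pos ha hD)
  have h2 := mul_log_sub_mul_log_le (sub_nonneg.2 hx.2) (div_pos one_pos hD)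
  rw [Real.log_div ha.ne' hD.ne'] at h1
  rw [Real.log_div one_ne_zero hD.ne', Real.log_one] at h2
  have h3 : a / (1 + a) + 1 / (1 + a) = 1 := by field_simp; ring
  rw [binEnt_eq_div, Real.logb, Real.logb, mul_div_assoc', ← sub_div]
  refine div_le_div_of_nonneg_right ?_ (Real.log_nonneg one_le_two)
  linarith

/-- The tangent line of the binary entropy at `a / (1 + a)` touches it there. -/
lemma binEnt_div_one_add {a : ℝ} (ha : 0 < a) :
    binEnt (a / (1 + a)) = Real.logb 2 (1 + a) - a / (1 + a) * Real.logb 2 a := by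
  have hD : 0 < 1 + a := by positivity
  have h : 1 - a / (1 + a) = 1 / (1 + a) := by field_simp; ring
  rw [binEnt, h, Real.logb_div ha.ne' hD.ne', Real.logb_div one_ne_zero hD.ne', Real.logb_one]
  field_simp
  ring

/-- For `ε ∈ (0,1)`, the supremum over `π ∈ [0,1]` of the Z-channel mutual information
`f(π) = H₂(π(1-ε)) - π·H₂(ε)` equals `log₂(1 - ε^{1/(1-ε)} + ε^{ε/(1-ε)})`, and it is
attained at `π* = ε^{ε/(1-ε)} / (1 + (1-ε)·ε^{ε/(1-ε)})` (unconstrained capacity of the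
Z-channel with 1-to-0 crossover probability `ε`). -/
theorem z_channel_capacity (ε : ℝ) (hε : ε ∈ Set.Ioo (0 : ℝ) 1) :
    IsGreatest {y : ℝ | ∃ π ∈ Set.Icc (0 : ℝ) 1, y = binEnt (π * (1 - ε)) - π * binEnt ε}
      (Real.logb 2 (1 - ε ^ (1 / (1 - ε)) + ε ^ (ε / (1 - ε)))) ∧
    ε ^ (ε / (1 - ε)) / (1 + (1 - ε) * ε ^ (ε / (1 - ε))) ∈ Set.Icc (0 : ℝ) 1 ∧
    binEnt ((ε ^ (ε / (1 - ε)) / (1 + (1 - ε) * ε ^ (ε / (1 - ε)))) * (1 - ε)) -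
        (ε ^ (ε / (1 - ε)) / (1 + (1 - ε) * ε ^ (ε / (1 - ε)))) * binEnt ε =
      Real.logb 2 (1 - ε ^ (1 / (1 - ε)) + ε ^ (ε / (1 - ε))) := by
  obtain ⟨h0, h1⟩ := hε
  have hd : 0 < 1 - ε := sub_pos.2 h1
  have ht_pos : 0 < ε ^ (ε / (1 - ε)) := Real.rpow_pos_of_pos h0 _
  have ht_le : ε ^ (ε / (1 - ε)) ≤ 1 := Real.rpow_le_one h0.le h1.le (by positivity)
  have hlog : Real.logb 2 (ε ^ (ε / (1 - ε))) = ε / (1 - ε) * Real.logb 2 ε :=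
    Real.logb_rpow_eq_mul_logb_of_pos h0
  have hpow : ε ^ (1 / (1 - ε)) = ε * ε ^ (ε / (1 - ε)) := by
    rw [← Real.rpow_one_add' h0.le (by positivity)]
    congr 1
    field_simp
    ring
  rw [hpow]
  generalize ε ^ (ε / (1 - ε)) = t at *
  have hD : 1 - ε * t + t = 1 + (1 - ε) * t := by ring
  rw [hD]
  have ha : 0 < (1 - ε) * t := by positivity
  have hent (π : ℝ) : π * binEnt ε = -(π * (1 - ε) * Real.logb 2 ((1 - ε) * t)) := by
    rw [Real.logb_mul hd.ne' ht_pos.ne', hlog, binEnt]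
    field_simp
    ring
  have hmem : t / (1 + (1 - ε) * t) ∈ Set.Icc (0 : ℝ) 1 := by
    refine ⟨by positivity, (div_le_one (by positivity)).2 ?_⟩
    nlinarith
  have heq : binEnt (t / (1 + (1 - ε) * t) * (1 - ε)) - t / (1 + (1 - ε) * t) * binEnt ε =
      Real.logb 2 (1 + (1 - ε) * t) := by
    have hq : t / (1 + (1 - ε) * t) * (1 - ε) = (1 - ε) * t / (1 + (1 - ε) * t) := by ring
    rw [hent, hq, binEnt_div_one_add ha]
    ring
  refine ⟨⟨⟨_, hmem, heq.symm⟩, ?_⟩, hmem, heq⟩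
  rintro y ⟨π, ⟨hπ0, hπ1⟩, rfl⟩
  have hq : π * (1 - ε) ∈ Set.Icc (0 : ℝ) 1 :=
    ⟨by positivity, mul_le_one₀ hπ1 hd.le (by linarith)⟩
  have hle := binEnt_le_logb_one_add_sub ha hq
  rw [hent]
  linarith
end

section
/- Let SNR₂₁ > 0 and SNR₂₂ > 0, and let b be a real number with 1 + SNR₂₁ + SNR₂₂ < b ≤ 1 + SNR₂₁ + SNR₂₂ + 2√(SNR₂₁·SNR₂₂). Then there exist β₁, β₂ ∈ [0, 1) such that b = 1 + SNR₂₁ + SNR₂₂ + 2√((1-β₁)·SNR₂₁·(1-β₂)·SNR₂₂). (This establishes the nonemptiness of the η-Nash equilibrium information-energy region N(b) for every feasible minimum energy rate b, i.e., an η-Nash equilibrium exists, with η arbitrarily small, whenever the simultaneous energy and information transmission problem is feasible: b ≤ 1 + SNR₂₁ + SNR₂₂ + 2√(SNR₂₁·SNR₂₂).) -/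
/-- For `SNR₂₁, SNR₂₂ > 0` and any minimum energy rate
`b ∈ (1 + SNR₂₁ + SNR₂₂, 1 + SNR₂₁ + SNR₂₂ + 2√(SNR₂₁·SNR₂₂)]`, there exist power splits
`β₁, β₂ ∈ [0,1)` with `b = 1 + SNR₂₁ + SNR₂₂ + 2√((1-β₁)·SNR₂₁·(1-β₂)·SNR₂₂)`:
the η-Nash equilibrium information-energy region `N(b)` is nonempty whenever the SEIT
problem is feasible. -/
theorem nash_equilibrium_exists (SNR21 SNR22 b : ℝ) (h21 : 0 < SNR21) (h22 : 0 < SNR22)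
    (hb1 : 1 + SNR21 + SNR22 < b)
    (hb2 : b ≤ 1 + SNR21 + SNR22 + 2 * Real.sqrt (SNR21 * SNR22)) :
    ∃ β₁ ∈ Set.Ico (0 : ℝ) 1, ∃ β₂ ∈ Set.Ico (0 : ℝ) 1,
      b = 1 + SNR21 + SNR22 +
        2 * Real.sqrt ((1 - β₁) * SNR21 * ((1 - β₂) * SNR22)) := by
  have hS : 0 < √(SNR21 * SNR22) := Real.sqrt_pos.mpr (mul_pos h21 h22)
  set t : ℝ := (b - (1 + SNR21 + SNR22)) / 2 / √(SNR21 * SNR22) with ht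
  have ht0 : 0 < t := div_pos (by linarith) hS
  have ht1 : t ≤ 1 := (div_le_one hS).mpr (by linarith)
  have hmem : 1 - t ∈ Set.Ico (0 : ℝ) 1 := ⟨by linarith, by linarith⟩
  refine ⟨1 - t, hmem, 1 - t, hmem, ?_⟩
  have hprod : (1 - (1 - t)) * SNR21 * ((1 - (1 - t)) * SNR22) = t ^ 2 * (SNR21 * SNR22) := by
    ring
  rw [hprod, Real.sqrt_mul (sq_nonneg t), Real.sqrt_sq ht0.le, ht, div_mul_cancel₀ _ hS.ne']
  ring
end
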